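/- arXiv:1208.3732 — 4 statements merged into one kernel-verified Lean document; each statement's English description precedes it below -/
import Mathlib

section
/- Let N ≥ 4 be a real number, λ ≥ 0, and let f(z) = ∑_{k=0}^∞ c_k z^k be a power series with infinite radius of convergence. Then for every prescribed value a₀ ∈ ℝ there exists a power series y(z) = ∑_{k=0}^∞ a_k z^k with infinite radius of convergence such that y(0) = a₀ and −λ·y(z) − (z·y''(z) + (N/2)·y'(z)) = f(z) for all z ∈ ℝ. The coefficients satisfy the recurrence a_{k+1} = −(λ·a_k + c_k)/((k+1)(k+N/2)). -/
open MeasureTheory Real Set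

noncomputable section

/-- The degenerate operator `Δy(z) = z y''(z) + (N/2) y'(z)`. -/
def Del (N : ℝ) (f : ℝ → ℝ) : ℝ → ℝ :=
  fun z => z * deriv (deriv f) z + (N / 2) * deriv f z

/-- Iterates `Δ^m`. -/
def DelIter (N : ℝ) : ℕ → (ℝ → ℝ) → ℝ → ℝ
  | 0 => fun f => f
  | m + 1 => fun f => Del N (DelIter N m f)

/-- `Ḋ = √z d/dz`. -/
def Ddot (f : ℝ → ℝ) : ℝ → ℝ := fun z => Real.sqrt z * deriv f z

/-- The weighted L² norm on (0,1). -/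
def Xnorm (N : ℝ) (f : ℝ → ℝ) : ℝ :=
  Real.sqrt (∫ z in (0:ℝ)..1, (f z) ^ 2 * z ^ (N / 2 - 1))

/-- Graded seminorms `(y)_ℓ`. -/
def gnorm (N : ℝ) (ℓ : ℕ) (f : ℝ → ℝ) : ℝ :=
  if ℓ % 2 = 0 then Xnorm N (DelIter N (ℓ / 2) f)
  else Xnorm N (Ddot (DelIter N (ℓ / 2) f))

/-- Graded norm `‖y‖_n`. -/
def normN (N : ℝ) (n : ℕ) (f : ℝ → ℝ) : ℝ :=
  Real.sqrt (∑ ℓ ∈ Finset.range (n + 1), (gnorm N ℓ f) ^ 2)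

/-- Sup norm on [0,1]. -/
def supN (f : ℝ → ℝ) : ℝ := ⨆ z : Icc (0:ℝ) 1, |f z.1|

/-- `|y|_n = ∑_{ℓ≤n} ‖Ḋ^ℓ y‖_{L^∞(0,1)}`. -/
def supLow (n : ℕ) (f : ℝ → ℝ) : ℝ := ∑ ℓ ∈ Finset.range (n + 1), supN (Ddot^[ℓ] f)

/-- Time derivative of a function of (t,z). -/
def dt (y : ℝ → ℝ → ℝ) : ℝ → ℝ → ℝ := fun t z => deriv (fun s => y s z) t

/-- Sup norm on [0,T]×[0,1]. -/
def supT (T : ℝ) (y : ℝ → ℝ → ℝ) : ℝ :=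
  ⨆ (t : Icc (0:ℝ) T) (z : Icc (0:ℝ) 1), |y t.1 z.1|

/-- `|y|_n^T = sup_{j+k≤n} ‖∂_t^j Ḋ^k y‖_{L^∞([0,T]×[0,1])}`. -/
def supNT (T : ℝ) (n : ℕ) (y : ℝ → ℝ → ℝ) : ℝ :=
  ⨆ p : {p : ℕ × ℕ // p.1 + p.2 ≤ n}, supT T (fun t => Ddot^[p.1.2] (dt^[p.1.1] y t))

/-- `‖y‖_n^T`. -/
def normT (N T : ℝ) (n : ℕ) (y : ℝ → ℝ → ℝ) : ℝ :=
  Real.sqrt (∑ j ∈ Finset.range (n + 1), ∑ k ∈ Finset.range (n + 1 - j),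
    ∫ t in (0:ℝ)..T, (normN N k (dt^[j] y t)) ^ 2)

/-- `Z_n(H)(t) = ∑_{j+k=n} ‖∂_t^j H(t,·)‖_k`. -/
def ZZ (N : ℝ) (n : ℕ) (H : ℝ → ℝ → ℝ) (t : ℝ) : ℝ :=
  ∑ j ∈ Finset.range (n + 1), normN N (n - j) (dt^[j] H t)

/-- The operator `𝒜h = -b₂ Δh + b₁ Ďh + b₀ h` with time-dependent coefficients. -/
def opA (N : ℝ) (b₂ b₁ b₀ : ℝ → ℝ → ℝ) (H : ℝ → ℝ → ℝ) : ℝ → ℝ → ℝ :=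
  fun t z => -(b₂ t z) * Del N (H t) z + b₁ t z * (z * deriv (H t) z) + b₀ t z * H t z

end

def EntC (a : ℕ → ℝ) : Prop := ∀ R : ℝ, 0 < R → ∃ C : ℝ, ∀ k, |a k| * R ^ k ≤ C

lemma EntC.summable_abs {a : ℕ → ℝ} (h : EntC a) (z : ℝ) :
    Summable (fun k => |a k| * |z| ^ k) := by
  obtain ⟨C, hC⟩ := h (2 * (|z| + 1)) (by positivity)
  refine Summable.of_nonneg_of_le (fun k => by positivity) (fun k => ?_)
    ((summable_geometric_two).mul_left C)
  calc |a k| * |z| ^ k ≤ |a k| * (|z| + 1) ^ k := by gcongr; linarith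
    _ = (|a k| * (2 * (|z| + 1)) ^ k) * (1 / 2) ^ k := by
      rw [mul_assoc, ← mul_pow]; congr 2; ring
    _ ≤ C * (1 / 2) ^ k := by gcongr; exact hC k

lemma EntC.summable {a : ℕ → ℝ} (h : EntC a) (z : ℝ) :
    Summable (fun k => a k * z ^ k) := by
  refine Summable.of_norm ?_
  simpa [abs_mul, abs_pow] using h.summable_abs z

lemma EntC.der {a : ℕ → ℝ} (h : EntC a) : EntC (fun k => ((k : ℝ) + 1) * a (k + 1)) := by
  intro R hR
  obtain ⟨C, hC⟩ := h (2 * R) (by positivity)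
  refine ⟨C / R, fun k => ?_⟩
  rw [le_div_iff₀ hR]
  refine le_trans ?_ (hC (k + 1))
  have h2 : ((k : ℝ) + 1) ≤ 2 ^ (k + 1) := by
    have := (Nat.lt_two_pow_self (n := k + 1)).le
    exact_mod_cast this
  rw [abs_mul, abs_of_nonneg (by positivity : (0 : ℝ) ≤ (k : ℝ) + 1)]
  calc ((k : ℝ) + 1) * |a (k + 1)| * R ^ k * R = ((k : ℝ) + 1) * (|a (k + 1)| * R ^ (k + 1)) := by ring
    _ ≤ 2 ^ (k + 1) * (|a (k + 1)| * R ^ (k + 1)) := by gcongr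
    _ = _ := by rw [mul_pow]; ring

lemma EntC.hasDerivAt {a : ℕ → ℝ} (h : EntC a) (z : ℝ) :
    HasDerivAt (fun w : ℝ => ∑' k, a k * w ^ k)
      (∑' k : ℕ, (((k : ℝ) + 1) * a (k + 1)) * z ^ k) z := by
  have hu : Summable (fun k : ℕ => |a k| * (k * (|z| + 1) ^ (k - 1))) := by
    rw [← summable_nat_add_iff 1]
    refine (h.der.summable_abs (|z| + 1)).congr fun k => ?_
    rw [abs_mul, abs_of_nonneg (by positivity : (0 : ℝ) ≤ (k : ℝ) + 1),
      abs_of_nonneg (by positivity : (0 : ℝ) ≤ |z| + 1)]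
    push_cast [Nat.add_sub_cancel]
    ring
  have hb : ∀ k : ℕ, ∀ y ∈ Metric.ball (0 : ℝ) (|z| + 1),
      ‖a k * (k * y ^ (k - 1))‖ ≤ |a k| * (k * (|z| + 1) ^ (k - 1)) := by
    intro k y hy
    have hy' : |y| ≤ |z| + 1 := by simpa using (mem_ball_zero_iff.1 hy).le
    simp only [norm_mul, norm_pow, Real.norm_eq_abs, Nat.abs_cast]
    gcongr
  have hz : z ∈ Metric.ball (0 : ℝ) (|z| + 1) := by simp
  have := hasDerivAt_tsum_of_isPreconnected hu Metric.isOpen_ball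
    (convex_ball (0 : ℝ) (|z| + 1)).isPreconnected
    (fun k y _ => (hasDerivAt_pow k y).const_mul (a k)) hb hz (h.summable z) hz
  suffices hh : (∑' k : ℕ, (((k : ℝ) + 1) * a (k + 1)) * z ^ k) =
      ∑' n : ℕ, a n * (n * z ^ (n - 1)) by
    rw [hh]; exact this
  rw [(Summable.of_norm_bounded hu (fun k => hb k z hz)).tsum_eq_zero_add]
  simp only [Nat.cast_zero, zero_mul, mul_zero, zero_add]
  refine tsum_congr fun k => ?_
  push_cast [Nat.add_sub_cancel]
  ring

lemma entC_of_summable {c : ℕ → ℝ} (h : ∀ z : ℝ, Summable (fun k => c k * z ^ k)) : EntC c := by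
  intro R hR
  have h1 := ((h R).tendsto_atTop_zero).norm.bddAbove_range
  obtain ⟨C, hC⟩ := h1
  refine ⟨C, fun k => ?_⟩
  have := hC ⟨k, rfl⟩
  simpa [abs_mul, abs_pow, abs_of_pos hR] using this

noncomputable def recA (N lam : ℝ) (c : ℕ → ℝ) (a₀ : ℝ) : ℕ → ℝ
  | 0 => a₀
  | k + 1 => -(lam * recA N lam c a₀ k + c k) / ((k + 1) * (k + N / 2))

lemma entC_rec {N lam : ℝ} (hN : 4 ≤ N) (hlam : 0 ≤ lam) {c a : ℕ → ℝ} (hc : EntC c)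
    (ha : ∀ k : ℕ, a (k + 1) = -(lam * a k + c k) / ((k + 1) * (k + N / 2))) : EntC a := by
  intro R hR
  obtain ⟨C, hC⟩ := hc R hR
  obtain ⟨K, hK⟩ := exists_nat_ge (R * (lam + 1))
  have hC0 : 0 ≤ C := le_trans (by positivity) (hC 0)
  set S := ∑ j ∈ Finset.range (K + 1), |a j| * R ^ j with hS
  have hS0 : 0 ≤ S := Finset.sum_nonneg fun j _ => by positivity
  refine ⟨C + S, fun k => ?_⟩
  induction k with
  | zero =>
    have := Finset.single_le_sum (f := fun j => |a j| * R ^ j) (fun j _ => by positivity)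
      (Finset.mem_range.2 (Nat.succ_pos K))
    linarith
  | succ k ih =>
    by_cases hk : k + 1 < K + 1
    · have := Finset.single_le_sum (f := fun j => |a j| * R ^ j) (fun j _ => by positivity)
        (Finset.mem_range.2 hk)
      linarith
    · have hk' : (K : ℝ) ≤ k := by exact_mod_cast (by omega : K ≤ k)
      have hD : 0 < ((k : ℝ) + 1) * (k + N / 2) := by positivity
      have hD2 : R * (lam + 1) ≤ ((k : ℝ) + 1) * (k + N / 2) := by
        have : (0 : ℝ) ≤ k := by positivity
        nlinarith
      rw [ha k, abs_div, abs_neg, abs_of_pos hD, div_mul_eq_mul_div, div_le_iff₀ hD]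
      have h1 : |lam * a k + c k| ≤ lam * |a k| + |c k| := by
        refine (abs_add_le _ _).trans ?_
        rw [abs_mul, abs_of_nonneg hlam]
      calc |lam * a k + c k| * R ^ (k + 1) ≤ (lam * |a k| + |c k|) * R ^ (k + 1) := by gcongr
        _ = R * (lam * (|a k| * R ^ k) + |c k| * R ^ k) := by ring
        _ ≤ R * (lam * (C + S) + (C + S)) := by
          gcongr
          linarith [hC k]
        _ = (C + S) * (R * (lam + 1)) := by ring
        _ ≤ _ := by gcongr

theorem stmt2 (N : ℝ) (hN : 4 ≤ N) (lam : ℝ) (hlam : 0 ≤ lam)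
    (c : ℕ → ℝ) (f : ℝ → ℝ)
    (hf : ∀ z : ℝ, HasSum (fun k => c k * z ^ k) (f z))
    (a₀ : ℝ) :
    ∃ a : ℕ → ℝ, a 0 = a₀ ∧
      (∀ k : ℕ, a (k + 1) = -(lam * a k + c k) / ((k + 1) * (k + N / 2))) ∧
      (∀ z : ℝ, Summable (fun k => a k * z ^ k)) ∧
      (fun z : ℝ => ∑' k, a k * z ^ k) 0 = a₀ ∧
      (∀ z : ℝ,
        -lam * (∑' k, a k * z ^ k)
          - (z * deriv (deriv (fun w : ℝ => ∑' k, a k * w ^ k)) z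
              + (N / 2) * deriv (fun w : ℝ => ∑' k, a k * w ^ k) z) = f z) := by

  have hc : EntC c := entC_of_summable fun z => (hf z).summable
  have hrec : ∀ k : ℕ, recA N lam c a₀ (k + 1) =
    -(lam * recA N lam c a₀ k + c k) / ((k + 1) * (k + N / 2)) := fun k => rfl
  have h0 : recA N lam c a₀ 0 = a₀ := rfl
  generalize recA N lam c a₀ = a at hrec h0
  have hE : EntC a := entC_rec hN hlam hc hrec
  refine ⟨a, h0, hrec, hE.summable, ?_, fun z => ?_⟩
  · change ∑' k, a k * (0 : ℝ) ^ k = a₀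
    rw [tsum_eq_single 0 (fun k hk => by simp [hk])]
    simpa using h0
  · have hd : deriv (fun w : ℝ => ∑' k, a k * w ^ k) =
        fun w => ∑' k : ℕ, (((k : ℝ) + 1) * a (k + 1)) * w ^ k :=
      funext fun w => (hE.hasDerivAt w).deriv
    rw [hd, (hE.der.hasDerivAt z).deriv]
    have s0 := (hE.summable z).hasSum
    have s1 := (hE.der.summable z).hasSum
    have s2 := ((hE.der.der.summable z).hasSum).mul_left z
    have s3 : HasSum (fun k : ℕ => (k : ℝ) * (((k : ℝ) + 1) * a (k + 1)) * z ^ k)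
        (z * ∑' k : ℕ, (((k : ℝ) + 1) * ((((k + 1 : ℕ) : ℝ) + 1) * a (k + 1 + 1))) * z ^ k) := by
      rw [← hasSum_nat_add_iff' 1]
      simp only [Finset.range_one, Finset.sum_singleton, Nat.cast_zero, zero_mul, sub_zero]
      refine s2.congr_fun ?_
      intro k
      push_cast
      ring
    refine HasSum.unique ?_ (hf z)
    have := (s0.mul_left (-lam)).sub (s3.add (s1.mul_left (N / 2)))
    refine this.congr_fun ?_
    intro k
    have hD : ((k : ℝ) + 1) * (k + N / 2) ≠ 0 := by positivity
    have hk := hrec k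
    rw [eq_div_iff hD] at hk
    linear_combination (z ^ k) * hk
end

section
/- Let N ≥ 4 be a real number and let y ∈ C^∞([0,1]). Then for every m ∈ ℕ and all z ∈ (0,1]: (Δ^m(Dy))(z) = z^{−(N/2+m)} ∫_0^z (Δ^{m+1}y)(ζ)·ζ^{N/2+m−1} dζ. Consequently, for all m, k ∈ ℕ: ‖Δ^m D^k y‖_{L^∞(0,1)} ≤ (∏_{j=0}^{k−1} (N/2 + m + j))^{−1} · ‖Δ^{m+k} y‖_{L^∞(0,1)}. -/
open MeasureTheory Real Set

lemma contDiff_deriv_aux {f : ℝ → ℝ} (hf : ContDiff ℝ (⊤ : ℕ∞) f) :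
    ContDiff ℝ (⊤ : ℕ∞) (deriv f) := (contDiff_infty_iff_deriv.1 hf).2

lemma diff_aux {f : ℝ → ℝ} (hf : ContDiff ℝ (⊤ : ℕ∞) f) (z : ℝ) : HasDerivAt f (deriv f z) z :=
  ((contDiff_infty_iff_deriv.1 hf).1 z).hasDerivAt

lemma contDiff_Del_aux (N : ℝ) {f : ℝ → ℝ} (hf : ContDiff ℝ (⊤ : ℕ∞) f) :
    ContDiff ℝ (⊤ : ℕ∞) (Del N f) := by
  have h1 := contDiff_deriv_aux hf
  have h2 := contDiff_deriv_aux h1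
  unfold Del
  fun_prop

lemma contDiff_DelIter_aux (N : ℝ) (m : ℕ) {f : ℝ → ℝ} (hf : ContDiff ℝ (⊤ : ℕ∞) f) :
    ContDiff ℝ (⊤ : ℕ∞) (DelIter N m f) := by
  induction m with
  | zero => exact hf
  | succ m ih => exact contDiff_Del_aux N ih

lemma comm_aux (N c : ℝ) {g : ℝ → ℝ} (hg : ContDiff ℝ (⊤ : ℕ∞) g) :
    Del N (fun z => z * deriv g z + c * g z)
      = fun z => z * deriv (Del N g) z + (c + 1) * Del N g z := by
  have h1 := contDiff_deriv_aux hg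
  have h2 := contDiff_deriv_aux h1
  have e1 : deriv (fun z => z * deriv g z + c * g z)
      = fun z => z * deriv (deriv g) z + (c + 1) * deriv g z := by
    funext z
    have := (((hasDerivAt_id z).mul (diff_aux h1 z)).add ((diff_aux hg z).const_mul c)).deriv
    refine Eq.trans this ?_
    simp only [id]; ring
  have e2 : deriv (fun z => z * deriv (deriv g) z + (c + 1) * deriv g z)
      = fun z => z * deriv (deriv (deriv g)) z + (c + 2) * deriv (deriv g) z := by
    funext z
    have := (((hasDerivAt_id z).mul (diff_aux h2 z)).add ((diff_aux h1 z).const_mul (c+1))).deriv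
    refine Eq.trans this ?_
    simp only [id]; ring
  have e3 : deriv (Del N g)
      = fun z => z * deriv (deriv (deriv g)) z + (N / 2 + 1) * deriv (deriv g) z := by
    funext z
    have := (((hasDerivAt_id z).mul (diff_aux h2 z)).add ((diff_aux h1 z).const_mul (N/2))).deriv
    refine Eq.trans this ?_
    simp only [id]; ring
  funext z
  rw [e3]
  unfold Del
  rw [e1, e2]
  ring

lemma key_aux (N : ℝ) {y : ℝ → ℝ} (hy : ContDiff ℝ (⊤ : ℕ∞) y) (m : ℕ) :
    DelIter N (m + 1) y = fun z => z * deriv (DelIter N m (deriv y)) z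
      + (N / 2 + (m : ℝ)) * DelIter N m (deriv y) z := by
  induction m with
  | zero => funext z; simp [DelIter, Del]
  | succ m ih =>
    have h := comm_aux N (N / 2 + (m : ℝ)) (contDiff_DelIter_aux N m (contDiff_deriv_aux hy))
    rw [← ih] at h
    refine Eq.trans h ?_
    funext z
    simp only [DelIter]
    push_cast
    ring

lemma int_aux (N : ℝ) (hN : 4 ≤ N) {y : ℝ → ℝ} (hy : ContDiff ℝ (⊤ : ℕ∞) y) (m : ℕ) (z : ℝ)
    (hz : 0 < z) :
    ∫ ζ in (0:ℝ)..z, DelIter N (m + 1) y ζ * ζ ^ (N / 2 + (m:ℝ) - 1)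
      = z ^ (N / 2 + (m:ℝ)) * DelIter N m (deriv y) z := by
  have hm : (0:ℝ) ≤ m := m.cast_nonneg
  have hg := contDiff_DelIter_aux N m (contDiff_deriv_aux hy)
  have hc : Continuous (fun ζ : ℝ => DelIter N (m + 1) y ζ * ζ ^ (N / 2 + (m:ℝ) - 1)) :=
    (contDiff_DelIter_aux N (m+1) hy).continuous.mul
      (Real.continuous_rpow_const (by linarith))
  rw [intervalIntegral.integral_eq_sub_of_hasDerivAt
    (f := fun z => z ^ (N / 2 + (m:ℝ)) * DelIter N m (deriv y) z) _ (hc.intervalIntegrable _ _)]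
  · rw [Real.zero_rpow (by linarith)]; simp
  · intro x hx
    rw [uIcc_of_le hz.le] at hx
    have h := (Real.hasDerivAt_rpow_const (x := x) (p := N / 2 + (m:ℝ))
      (Or.inr (by linarith))).mul (diff_aux hg x)
    refine h.congr_deriv ?_
    rw [key_aux N hy m]
    have : x ^ (N / 2 + (m:ℝ)) = x ^ (N / 2 + (m:ℝ) - 1) * x := by
      conv_lhs => rw [show N / 2 + (m:ℝ) = (N / 2 + (m:ℝ) - 1) + 1 by ring]
      rw [Real.rpow_add_one' hx.1 (by linarith)]
    rw [this]
    ring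

lemma le_supN_aux {f : ℝ → ℝ} (hf : Continuous f) {z : ℝ} (hz : z ∈ Icc (0:ℝ) 1) :
    |f z| ≤ supN f := by
  have hb : BddAbove (range fun z : Icc (0:ℝ) 1 => |f z.1|) :=
    (isCompact_range (by fun_prop)).bddAbove
  exact le_ciSup hb ⟨z, hz⟩

lemma step_aux (N : ℝ) (hN : 4 ≤ N) {y : ℝ → ℝ} (hy : ContDiff ℝ (⊤ : ℕ∞) y) (m : ℕ) :
    supN (DelIter N m (deriv y)) ≤ (N / 2 + (m:ℝ))⁻¹ * supN (DelIter N (m + 1) y) := by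
  have hm : (0:ℝ) ≤ m := m.cast_nonneg
  have hpos : 0 < N / 2 + (m:ℝ) := by linarith
  have hcont := (contDiff_DelIter_aux N (m+1) hy).continuous
  haveI : Nonempty (Icc (0:ℝ) 1) := ⟨⟨0, by simp⟩⟩
  refine ciSup_le ?_
  rintro ⟨z, hz⟩
  simp only
  rw [← div_eq_inv_mul, le_div_iff₀ hpos]
  set M := supN (DelIter N (m + 1) y) with hM
  rcases hz.1.eq_or_lt with h0 | h0
  · have h := le_supN_aux hcont hz
    rw [← hM, key_aux N hy m] at h
    simp only [← h0, zero_mul, zero_add, abs_mul, abs_of_pos hpos] at h ⊢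
    linarith
  · have hI := int_aux N hN hy m z h0
    have hzp : 0 < z ^ (N / 2 + (m:ℝ)) := Real.rpow_pos_of_pos h0 _
    have hb : ‖∫ ζ in (0:ℝ)..z, DelIter N (m + 1) y ζ * ζ ^ (N / 2 + (m:ℝ) - 1)‖
        ≤ ∫ ζ in (0:ℝ)..z, M * ζ ^ (N / 2 + (m:ℝ) - 1) := by
      refine intervalIntegral.norm_integral_le_of_norm_le h0.le ?_ ?_
      · refine Filter.Eventually.of_forall fun t ht => ?_
        have ht0 := Real.rpow_nonneg ht.1.le (N / 2 + (m:ℝ) - 1)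
        rw [norm_mul, Real.norm_of_nonneg ht0, Real.norm_eq_abs]
        exact mul_le_mul_of_nonneg_right
          (le_supN_aux hcont ⟨ht.1.le, ht.2.trans hz.2⟩) ht0
      · exact (continuous_const.mul
          (Real.continuous_rpow_const (by linarith))).intervalIntegrable _ _
    rw [hI, intervalIntegral.integral_const_mul, integral_rpow (Or.inl (by linarith)),
      sub_add_cancel, Real.zero_rpow hpos.ne', sub_zero, norm_mul, Real.norm_of_nonneg hzp.le,
      Real.norm_eq_abs, ← mul_div_assoc, le_div_iff₀ hpos] at hb
    refine le_of_mul_le_mul_left ?_ hzp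
    linarith

theorem stmt5 (N : ℝ) (hN : 4 ≤ N) (y : ℝ → ℝ) (hy : ContDiff ℝ (⊤ : ℕ∞) y) :
    (∀ m : ℕ, ∀ z ∈ Ioc (0:ℝ) 1,
      DelIter N m (deriv y) z
        = z ^ (-(N / 2 + (m:ℝ)))
            * ∫ ζ in (0:ℝ)..z, DelIter N (m + 1) y ζ * ζ ^ (N / 2 + (m:ℝ) - 1)) ∧
    (∀ m k : ℕ,
      supN (DelIter N m (deriv^[k] y))
        ≤ (∏ j ∈ Finset.range k, (N / 2 + (m:ℝ) + (j:ℝ)))⁻¹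
            * supN (DelIter N (m + k) y)) := by
  constructor
  · intro m z hz
    rw [int_aux N hN hy m z hz.1, ← mul_assoc, ← Real.rpow_add hz.1]
    simp
  · intro m k
    have hsm : ∀ k, ContDiff ℝ (⊤ : ℕ∞) (deriv^[k] y) := by
      intro k
      induction k with
      | zero => exact hy
      | succ k ih => rw [Function.iterate_succ_apply']; exact contDiff_deriv_aux ih
    induction k generalizing m with
    | zero => simp
    | succ k ih =>
      have hm : (0:ℝ) ≤ m := m.cast_nonneg
      rw [Function.iterate_succ_apply']
      refine (step_aux N hN (hsm k) m).trans ?_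
      have h := mul_le_mul_of_nonneg_left (ih (m + 1))
        (inv_nonneg.2 (by linarith : 0 ≤ N / 2 + (m:ℝ)))
      refine h.trans (le_of_eq ?_)
      rw [Finset.prod_range_succ', ← mul_assoc, mul_inv, show m + 1 + k = m + (k + 1) by ring]
      have : ∀ j : ℕ, N / 2 + ((m + 1 : ℕ):ℝ) + (j:ℝ) = N / 2 + (m:ℝ) + ((j + 1 : ℕ):ℝ) := by
        intro j; push_cast; ring
      simp only [this, Nat.cast_zero, add_zero]
      ring
end

section
/- Let N ≥ 4 be a real number and let α ∈ C^∞(ℝ) be fixed. For every n ∈ ℕ there is a constant C = C(n, N, α) such that ‖α·y‖_n ≤ C·‖y‖_n for all y ∈ C^∞([0,1]). -/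
open MeasureTheory Real Set

/-- Pointwise graded derivative. -/
noncomputable def PP (N : ℝ) (l : ℕ) (f : ℝ → ℝ) : ℝ → ℝ :=
  if l % 2 = 0 then DelIter N (l / 2) f else Ddot (DelIter N (l / 2) f)

noncomputable def TT (N : ℝ) (n : ℕ) (f : ℝ → ℝ) (z : ℝ) : ℝ :=
  ∑ j ∈ Finset.range (n + 1), |PP N j f z|

abbrev Sm (f : ℝ → ℝ) : Prop := ContDiff ℝ (⊤ : ℕ∞) f

lemma Sm.der {f : ℝ → ℝ} (hf : Sm f) : Sm (deriv f) :=
  (contDiff_infty_iff_deriv.1 hf).2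

lemma Sm.diff {f : ℝ → ℝ} (hf : Sm f) : Differentiable ℝ f :=
  (contDiff_infty_iff_deriv.1 hf).1

lemma Sm.del {f : ℝ → ℝ} (N : ℝ) (hf : Sm f) : Sm (Del N f) := by
  unfold Del
  have h1 := hf.der
  have h2 := h1.der
  exact (contDiff_id.mul h2).add (contDiff_const.mul h1)

lemma Sm.delIter {f : ℝ → ℝ} (N : ℝ) (hf : Sm f) (m : ℕ) : Sm (DelIter N m f) := by
  induction m with
  | zero => exact hf
  | succ m ih => exact ih.del N

lemma delIter_del (N : ℝ) (m : ℕ) (f : ℝ → ℝ) :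
    DelIter N m (Del N f) = DelIter N (m + 1) f := by
  induction m with
  | zero => rfl
  | succ m ih => 
    change Del N (DelIter N m (Del N f)) = Del N (DelIter N (m+1) f)
    rw [ih]

lemma PP_del (N : ℝ) (n : ℕ) (f : ℝ → ℝ) : PP N n (Del N f) = PP N (n + 2) f := by
  unfold PP
  have h1 : (n + 2) % 2 = n % 2 := by omega
  have h2 : (n + 2) / 2 = n / 2 + 1 := by omega
  rw [h1, h2, delIter_del]

lemma deriv_add_sm {f g : ℝ → ℝ} (hf : Sm f) (hg : Sm g) :
    deriv (fun z => f z + g z) = fun z => deriv f z + deriv g z := by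
  funext z
  exact deriv_fun_add (hf.diff z) (hg.diff z)

lemma deriv_mul_sm {f g : ℝ → ℝ} (hf : Sm f) (hg : Sm g) :
    deriv (fun z => f z * g z) = fun z => deriv f z * g z + f z * deriv g z := by
  funext z
  exact deriv_fun_mul (hf.diff z) (hg.diff z)

lemma del_add (N : ℝ) {f g : ℝ → ℝ} (hf : Sm f) (hg : Sm g) :
    Del N (fun z => f z + g z) = fun z => Del N f z + Del N g z := by
  unfold Del
  rw [deriv_add_sm hf hg, deriv_add_sm hf.der hg.der]
  funext z
  ring

lemma delIter_add (N : ℝ) (m : ℕ) {f g : ℝ → ℝ} (hf : Sm f) (hg : Sm g) :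
    DelIter N m (fun z => f z + g z) = fun z => DelIter N m f z + DelIter N m g z := by
  induction m with
  | zero => rfl
  | succ m ih =>
    change Del N (DelIter N m _) = _
    rw [ih, del_add N (hf.delIter N m) (hg.delIter N m)]
    rfl

lemma PP_add (N : ℝ) (n : ℕ) {f g : ℝ → ℝ} (hf : Sm f) (hg : Sm g) (z : ℝ) :
    PP N n (fun z => f z + g z) z = PP N n f z + PP N n g z := by
  unfold PP
  rw [delIter_add N _ hf hg]
  split_ifs
  · rfl
  · unfold Ddot
    rw [deriv_add_sm (hf.delIter N _) (hg.delIter N _)]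
    ring

lemma deriv_id_mul {f : ℝ → ℝ} (hf : Sm f) :
    deriv (fun z => z * f z) = fun z => f z + z * deriv f z := by
  have := deriv_mul_sm (f := fun z => z) contDiff_id hf
  rw [this]
  funext z
  simp

lemma Sm.zmul {f : ℝ → ℝ} (hf : Sm f) : Sm (fun z => z * f z) :=
  ContDiff.mul (f := fun z => z) contDiff_id hf

/-- Commutation of Del and z d/dz. -/
lemma del_D (N : ℝ) {f : ℝ → ℝ} (hf : Sm f) :
    Del N (fun z => z * deriv f z) = fun z => z * deriv (Del N f) z + Del N f z := by
  have h1 := hf.der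
  have h2 := h1.der
  have e : deriv (Del N f) = fun z => (deriv (deriv f) z + z * deriv (deriv (deriv f)) z)
      + (N/2) * deriv (deriv f) z := by
    unfold Del
    rw [deriv_add_sm h2.zmul (contDiff_const.mul h1), deriv_id_mul h2]
    funext z
    rw [deriv_const_mul _ (h1.diff z)]
  rw [e]
  unfold Del
  rw [deriv_id_mul h1, deriv_add_sm h1 h2.zmul, deriv_id_mul h2]
  funext z
  ring

lemma del_smul (N c : ℝ) {f : ℝ → ℝ} (hf : Sm f) :
    Del N (fun z => c * f z) = fun z => c * Del N f z := by
  have e : ∀ {g : ℝ → ℝ}, Sm g → deriv (fun z => c * g z) = fun z => c * deriv g z := by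
    intro g hg
    funext z
    rw [deriv_const_mul _ (hg.diff z)]
  unfold Del
  rw [e hf, e hf.der]
  funext z
  ring

lemma delIter_D (N : ℝ) (m : ℕ) {f : ℝ → ℝ} (hf : Sm f) :
    DelIter N m (fun z => z * deriv f z) =
      fun z => z * deriv (DelIter N m f) z + m * DelIter N m f z := by
  induction m with
  | zero => funext z; simp [DelIter]
  | succ m ih =>
    change Del N (DelIter N m _) = _
    have h := hf.delIter N m
    rw [ih, del_add N h.der.zmul (contDiff_const.mul h), del_D N h, del_smul N _ h]
    funext z
    change _ = z * deriv (Del N (DelIter N m f)) z + ((m+1 : ℕ):ℝ) * Del N (DelIter N m f) z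
    push_cast
    ring

lemma PP_even (N : ℝ) (m : ℕ) (f : ℝ → ℝ) : PP N (2 * m) f = DelIter N m f := by
  unfold PP
  rw [if_pos (by omega)]
  congr 1; omega

lemma PP_odd (N : ℝ) (m : ℕ) (f : ℝ → ℝ) : PP N (2 * m + 1) f = Ddot (DelIter N m f) := by
  unfold PP
  rw [if_neg (by omega)]
  congr 2; omega

lemma le_TT (N : ℝ) {n j : ℕ} (h : j ≤ n) (f : ℝ → ℝ) (z : ℝ) : |PP N j f z| ≤ TT N n f z :=
  Finset.single_le_sum (f := fun j => |PP N j f z|) (fun _ _ => abs_nonneg _)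
    (Finset.mem_range.2 (by omega))

lemma TT_mono (N : ℝ) {n m : ℕ} (h : n ≤ m) (f : ℝ → ℝ) (z : ℝ) : TT N n f z ≤ TT N m f z :=
  Finset.sum_le_sum_of_subset_of_nonneg (Finset.range_mono (by omega))
    (fun _ _ _ => abs_nonneg _)

lemma TT_nonneg (N : ℝ) (n : ℕ) (f : ℝ → ℝ) (z : ℝ) : 0 ≤ TT N n f z :=
  Finset.sum_nonneg (fun _ _ => abs_nonneg _)

lemma TT_le (N : ℝ) {n : ℕ} {f : ℝ → ℝ} {z B : ℝ} (h : ∀ j ≤ n, |PP N j f z| ≤ B) :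
    TT N n f z ≤ (n + 1) * B := by
  have := Finset.sum_le_card_nsmul (Finset.range (n+1)) (fun j => |PP N j f z|) B
    (fun j hj => h j (by simpa [Nat.lt_succ_iff] using hj))
  simpa [TT] using this

lemma PP_D (N : ℝ) (n : ℕ) : ∃ C, 0 ≤ C ∧ ∀ f : ℝ → ℝ, Sm f → ∀ z ∈ Icc (0:ℝ) 1,
    |PP N n (fun z => z * deriv f z) z| ≤ C * TT N (n + 1) f z := by
  rcases Nat.even_or_odd' n with ⟨m, rfl | rfl⟩
  · refine ⟨1 + m, by positivity, fun f hf z hz => ?_⟩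
    have a1 := le_TT N (le_refl (2*m+1)) f z
    have a2 := le_TT N (Nat.le_succ (2*m)) f z
    rw [PP_odd] at a1
    rw [PP_even] at a2 ⊢
    rw [delIter_D N m hf]
    simp only [Ddot] at a1
    set u := deriv (DelIter N m f) z
    set v := DelIter N m f z
    have hs : z * u = √z * (√z * u) := by rw [← mul_assoc, Real.mul_self_sqrt hz.1]
    have hs1 : √z ≤ 1 := Real.sqrt_le_one.2 hz.2
    have b1 : |z * u| ≤ |√z * u| := by
      rw [hs, abs_mul, abs_of_nonneg (Real.sqrt_nonneg z)]
      exact mul_le_of_le_one_left (abs_nonneg _) hs1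
    have b2 : |(m:ℝ) * v| ≤ m * TT N (2*m+1) f z := by
      rw [abs_mul, Nat.abs_cast]
      exact mul_le_mul_of_nonneg_left a2 (by positivity)
    calc _ ≤ |z * u| + |m * v| := abs_add_le _ _
      _ ≤ _ := by linarith
  · refine ⟨1 + (m + |1 - N/2|), by positivity, fun f hf z hz => ?_⟩
    have a1 := le_TT N (le_refl (2*m+1+1)) f z
    have a2 := le_TT N (Nat.le_succ (2*m+1)) f z
    have e : 2 * m + 1 + 1 = 2 * (m+1) := by ring
    have e' : PP N (2*m+1+1) f = Del N (DelIter N m f) := by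
      rw [e, PP_even]; rfl
    rw [e'] at a1
    rw [PP_odd] at a2 ⊢
    rw [delIter_D N m hf]
    have h := hf.delIter N m
    unfold Ddot at a2 ⊢
    rw [deriv_add_sm h.der.zmul (contDiff_const.mul h), deriv_id_mul h.der]
    simp only [deriv_const_mul _ (h.diff z)]
    unfold Del at a1
    set u := deriv (DelIter N m f) z
    set w := deriv (deriv (DelIter N m f)) z
    have hs1 : √z ≤ 1 := Real.sqrt_le_one.2 hz.2
    have eq : √z * (u + z * w + m * u) = √z * (z * w + N/2*u) + (m + (1-N/2)) * (√z * u) := by ring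
    rw [eq]
    have b1 : |√z * (z * w + N/2*u)| ≤ |z * w + N/2*u| := by
      rw [abs_mul, abs_of_nonneg (Real.sqrt_nonneg z)]
      exact mul_le_of_le_one_left (abs_nonneg _) hs1
    have b3 : |(m:ℝ) + (1-N/2)| ≤ m + |1-N/2| := by
      refine (abs_add_le _ _).trans ?_
      rw [Nat.abs_cast]
    have b2 : |((m:ℝ) + (1-N/2)) * (√z * u)| ≤ (m + |1-N/2|) * TT N (2*m+1+1) f z := by
      rw [abs_mul]
      exact mul_le_mul b3 a2 (abs_nonneg _) (by positivity)
    refine (abs_add_le _ _).trans ?_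
    linarith

lemma del_mul (N : ℝ) {a y : ℝ → ℝ} (ha : Sm a) (hy : Sm y) :
    Del N (fun z => a z * y z) = fun z => (a z * Del N y z + (2 * deriv a z) * (z * deriv y z))
      + Del N a z * y z := by
  unfold Del
  rw [deriv_mul_sm ha hy, deriv_add_sm (ha.der.mul hy) (ha.mul hy.der),
    deriv_mul_sm ha.der hy, deriv_mul_sm ha hy.der]
  funext z
  ring

lemma bdd_sm {a : ℝ → ℝ} (ha : Sm a) : ∃ M, 0 ≤ M ∧ ∀ z ∈ Icc (0:ℝ) 1, |a z| ≤ M := by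
  obtain ⟨M, hM⟩ := (isCompact_Icc (a := (0:ℝ)) (b := 1)).exists_bound_of_continuousOn
    ha.continuous.continuousOn
  exact ⟨M, (abs_nonneg _).trans (hM 0 (by simp)), hM⟩

lemma PP_mul (N : ℝ) (n : ℕ) : ∀ a : ℝ → ℝ, Sm a → ∃ C, 0 ≤ C ∧ ∀ y : ℝ → ℝ, Sm y →
    ∀ z ∈ Icc (0:ℝ) 1, |PP N n (fun z => a z * y z) z| ≤ C * TT N n y z := by
  induction n using Nat.twoStepInduction with
  | zero =>
    intro a ha
    obtain ⟨M, hM0, hM⟩ := bdd_sm ha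
    refine ⟨M, hM0, fun y hy z hz => ?_⟩
    have a0 := le_TT N (le_refl 0) y z
    change |a z * y z| ≤ _
    refine le_trans ?_ (mul_le_mul_of_nonneg_left a0 hM0)
    change _ ≤ M * |y z|
    rw [abs_mul]
    exact mul_le_mul_of_nonneg_right (hM z hz) (abs_nonneg _)
  | one =>
    intro a ha
    obtain ⟨M, hM0, hM⟩ := bdd_sm ha
    obtain ⟨M', hM0', hM'⟩ := bdd_sm ha.der
    refine ⟨M + M', by positivity, fun y hy z hz => ?_⟩
    have a0 := le_TT N (Nat.zero_le 1) y z
    have a1 := le_TT N (le_refl 1) y z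
    have e0 : PP N 0 y z = y z := rfl
    have e1 : PP N 1 y z = √z * deriv y z := rfl
    have e2 : PP N 1 (fun z => a z * y z) z = √z * deriv (fun z => a z * y z) z := rfl
    rw [e0] at a0
    rw [e1] at a1
    rw [e2, deriv_mul_sm ha hy]
    have hs1 : √z ≤ 1 := Real.sqrt_le_one.2 hz.2
    have eq : √z * (deriv a z * y z + a z * deriv y z)
      = √z * (deriv a z * y z) + a z * (√z * deriv y z) := by ring
    rw [eq]
    have b1 : |√z * (deriv a z * y z)| ≤ M' * TT N 1 y z := by
      rw [abs_mul, abs_of_nonneg (Real.sqrt_nonneg z)]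
      refine (mul_le_of_le_one_left (abs_nonneg _) hs1).trans ?_
      rw [abs_mul]
      exact mul_le_mul (hM' z hz) a0 (abs_nonneg _) hM0'
    have b2 : |a z * (√z * deriv y z)| ≤ M * TT N 1 y z := by
      rw [abs_mul (a z)]
      exact mul_le_mul (hM z hz) a1 (abs_nonneg _) hM0
    refine (abs_add_le _ _).trans ?_
    linarith
  | more n ih _ =>
    intro a ha
    have h2a : Sm (fun z => 2 * deriv a z) := contDiff_const.mul ha.der
    obtain ⟨C1, hC1, H1⟩ := ih a ha
    obtain ⟨C2, hC2, H2⟩ := ih _ h2a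
    obtain ⟨C3, hC3, H3⟩ := ih _ (ha.del N)
    choose K hK HK using PP_D N
    set L := ∑ j ∈ Finset.range (n+1), K j with hL
    have hL0 : 0 ≤ L := Finset.sum_nonneg (fun j _ => hK j)
    refine ⟨C1 * (n+1) + C2 * ((n+1) * L) + C3, by positivity, fun y hy z hz => ?_⟩
    have hT := TT_nonneg N (n+2) y z
    rw [← PP_del, del_mul N ha hy,
      PP_add N n ((ha.mul (hy.del N)).add (h2a.mul hy.der.zmul)) ((ha.del N).mul hy),
      PP_add N n (ha.mul (hy.del N)) (h2a.mul hy.der.zmul)]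
    have b1 : TT N n (Del N y) z ≤ (n+1) * TT N (n+2) y z := TT_le N fun j hj => by
      rw [PP_del]; exact le_TT N (by omega) y z
    have b2 : TT N n (fun z => z * deriv y z) z ≤ (n+1) * (L * TT N (n+2) y z) :=
      TT_le N fun j hj => by
        refine (HK j y hy z hz).trans ?_
        refine mul_le_mul ?_ (TT_mono N (by omega) y z) (TT_nonneg _ _ _ _) hL0
        exact Finset.single_le_sum (fun j _ => hK j) (Finset.mem_range.2 (by omega))
    have b3 : TT N n y z ≤ TT N (n+2) y z := TT_mono N (by omega) y z
    have c1 := (H1 _ (hy.del N) z hz).trans (mul_le_mul_of_nonneg_left b1 hC1)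
    have c2 := (H2 _ hy.der.zmul z hz).trans (mul_le_mul_of_nonneg_left b2 hC2)
    have c3 := (H3 _ hy z hz).trans (mul_le_mul_of_nonneg_left b3 hC3)
    refine (abs_add_le _ _).trans ?_
    refine (add_le_add_left (abs_add_le _ _) _).trans ?_
    refine (add_le_add (add_le_add c1 c2) c3).trans (le_of_eq ?_)
    ring

lemma PP_cont (N : ℝ) (n : ℕ) {f : ℝ → ℝ} (hf : Sm f) : Continuous (PP N n f) := by
  unfold PP
  split_ifs
  · exact (hf.delIter N _).continuous
  · exact Real.continuous_sqrt.mul (hf.delIter N _).der.continuous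

lemma gnorm_sq (N : ℝ) (n : ℕ) (f : ℝ → ℝ) :
    (gnorm N n f) ^ 2 = ∫ z in (0:ℝ)..1, (PP N n f z) ^ 2 * z ^ (N / 2 - 1) := by
  have : gnorm N n f = Xnorm N (PP N n f) := by
    unfold gnorm PP
    split_ifs <;> rfl
  rw [this, Xnorm, Real.sq_sqrt]
  apply intervalIntegral.integral_nonneg zero_le_one
  intro z hz
  have := Real.rpow_nonneg hz.1 (N/2-1)
  positivity

lemma integ (N : ℝ) (hN : 4 ≤ N) (n : ℕ) {f : ℝ → ℝ} (hf : Sm f) :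
    IntervalIntegrable (fun z => (PP N n f z) ^ 2 * z ^ (N / 2 - 1)) volume 0 1 := by
  apply Continuous.intervalIntegrable
  exact ((PP_cont N n hf).pow 2).mul (Real.continuous_rpow_const (by linarith))

lemma gnorm_mul (N : ℝ) (hN : 4 ≤ N) (n : ℕ) {a : ℝ → ℝ} (ha : Sm a) :
    ∃ C, 0 ≤ C ∧ ∀ y : ℝ → ℝ, Sm y → (gnorm N n (fun z => a z * y z)) ^ 2 ≤
      C * ∑ j ∈ Finset.range (n+1), (gnorm N j y) ^ 2 := by
  obtain ⟨C, hC, H⟩ := PP_mul N n a ha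
  refine ⟨C^2 * (n+1), by positivity, fun y hy => ?_⟩
  simp only [gnorm_sq]
  rw [← intervalIntegral.integral_finsetSum (fun j _ => integ N hN j hy),
    ← intervalIntegral.integral_const_mul]
  apply intervalIntegral.integral_mono_on zero_le_one (integ N hN n (ha.mul hy))
  · apply IntervalIntegrable.const_mul
    apply Continuous.intervalIntegrable
    exact continuous_finsetSum _ fun j _ =>
      ((PP_cont N j hy).pow 2).mul (Real.continuous_rpow_const (by linarith))
  · intro z hz
    rw [← Finset.sum_mul, ← mul_assoc]
    apply mul_le_mul_of_nonneg_right _ (Real.rpow_nonneg hz.1 _)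
    have h1 := H y hy z hz
    have h2 : (TT N n y z)^2 ≤ (n+1) * ∑ j ∈ Finset.range (n+1), (PP N j y z)^2 := by
      have := sq_sum_le_card_mul_sum_sq (s := Finset.range (n+1)) (f := fun j => |PP N j y z|)
      simpa [TT] using this
    calc _ = |PP N n (fun z => a z * y z) z|^2 := (sq_abs _).symm
      _ ≤ (C * TT N n y z)^2 := pow_le_pow_left₀ (abs_nonneg _) h1 2
      _ = C^2 * (TT N n y z)^2 := by ring
      _ ≤ C^2 * ((n+1) * ∑ j ∈ Finset.range (n+1), (PP N j y z)^2) :=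
        mul_le_mul_of_nonneg_left h2 (by positivity)
      _ = _ := by ring

theorem stmt8 (N : ℝ) (hN : 4 ≤ N) (α : ℝ → ℝ) (hα : ContDiff ℝ (⊤ : ℕ∞) α) (n : ℕ) :
    ∃ C > (0:ℝ), ∀ y : ℝ → ℝ, ContDiff ℝ (⊤ : ℕ∞) y →
      normN N n (fun z => α z * y z) ≤ C * normN N n y := by
  choose K hK HK using fun j => gnorm_mul N hN j (a := α) hα
  set L := ∑ j ∈ Finset.range (n+1), K j with hL
  have hL0 : 0 ≤ L := Finset.sum_nonneg (fun j _ => hK j)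
  refine ⟨√(L + 1), by positivity, fun y hy => ?_⟩
  unfold normN
  rw [← Real.sqrt_mul (by positivity)]
  apply Real.sqrt_le_sqrt
  have hS : 0 ≤ ∑ j ∈ Finset.range (n+1), (gnorm N j y) ^ 2 :=
    Finset.sum_nonneg fun _ _ => sq_nonneg _
  calc _ ≤ ∑ l ∈ Finset.range (n+1), K l * ∑ j ∈ Finset.range (n+1), (gnorm N j y) ^ 2 := by
        apply Finset.sum_le_sum
        intro l hl
        refine (HK l y hy).trans (mul_le_mul_of_nonneg_left ?_ (hK l))
        apply Finset.sum_le_sum_of_subset_of_nonneg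
        · apply Finset.range_mono
          have := Finset.mem_range.1 hl
          omega
        · intros; positivity
    _ = L * ∑ j ∈ Finset.range (n+1), (gnorm N j y) ^ 2 := by rw [← Finset.sum_mul]
    _ ≤ _ := by nlinarith
end

section
/- Let N ≥ 4 be a real number and m ∈ ℕ. There is a constant C = C(m,N) such that for all y ∈ C^∞([0,1]): ‖Ḋ Δ^m y‖_𝔛 ≤ C·( ‖Δ^m y‖_𝔛 + ‖Δ^{m+1} y‖_𝔛 ). -/
open MeasureTheory Real Set

theorem del_smooth (N : ℝ) (f : ℝ → ℝ) (hf : ContDiff ℝ (⊤ : ℕ∞) f) :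
    ContDiff ℝ (⊤ : ℕ∞) (Del N f) := by
  have h1 : ContDiff ℝ (⊤ : ℕ∞) (deriv f) := (contDiff_infty_iff_deriv.1 hf).2
  have h2 : ContDiff ℝ (⊤ : ℕ∞) (deriv (deriv f)) := (contDiff_infty_iff_deriv.1 h1).2
  unfold Del
  exact (contDiff_id.mul h2).add (contDiff_const.mul h1)

theorem delIter_smooth (N : ℝ) (m : ℕ) (f : ℝ → ℝ) (hf : ContDiff ℝ (⊤ : ℕ∞) f) :
    ContDiff ℝ (⊤ : ℕ∞) (DelIter N m f) := by
  induction m with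
  | zero => exact hf
  | succ k ih => exact del_smooth N _ ih

theorem key_ineq (N : ℝ) (hN : 4 ≤ N) (f : ℝ → ℝ) (hf : ContDiff ℝ (⊤ : ℕ∞) f) :
    (∫ z in (0:ℝ)..1, (Ddot f z) ^ 2 * z ^ (N / 2 - 1)) ≤
      (N / 2 + 3) * (∫ z in (0:ℝ)..1, (f z) ^ 2 * z ^ (N / 2 - 1)) +
      3 * (∫ z in (0:ℝ)..1, (Del N f z) ^ 2 * z ^ (N / 2 - 1)) := by
  have h1 : ContDiff ℝ (⊤ : ℕ∞) (deriv f) := (contDiff_infty_iff_deriv.1 hf).2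
  have cf : Continuous f := hf.continuous
  have c1 : Continuous (deriv f) := h1.continuous
  have c2 : Continuous (Del N f) := (del_smooth N f hf).continuous
  have cw : Continuous (fun z : ℝ => z ^ (N / 2 - 1)) :=
    continuous_id.rpow_const (fun _ => Or.inr (by linarith))
  have cD : Continuous (Ddot f) := by
    unfold Ddot
    exact Real.continuous_sqrt.mul c1
  have ca : Continuous (fun z : ℝ => z ^ (N / 2)) :=
    continuous_id.rpow_const (fun _ => Or.inr (by linarith))
  set G : ℝ → ℝ := fun z => z ^ (N / 2) * (f z * deriv f z)
    - ((z ^ (N / 2) * deriv f z) ^ 2 + z ^ (N / 2) * f z ^ 2) / 2 with hG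
  set g : ℝ → ℝ := fun z => z ^ (N / 2 - 1) * (z * deriv f z ^ 2 + f z * Del N f z
    - z ^ (N / 2) * deriv f z * Del N f z - N / 2 * f z ^ 2 / 2 - z * f z * deriv f z) with hg
  have cg : Continuous g := by rw [hg]; fun_prop
  have cG : Continuous G := by rw [hG]; fun_prop
  have hz : ∀ z : ℝ, 0 < z → z ^ (N / 2) = z * z ^ (N / 2 - 1) := by
    intro z hz
    rw [Real.rpow_sub_one hz.ne']
    field_simp
  have hd : ∀ z ∈ Ioo (0:ℝ) 1, HasDerivAt G (g z) z := by
    intro z hzz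
    have e1 : HasDerivAt f (deriv f z) z :=
      (hf.differentiable (by simp) z).hasDerivAt
    have e2 : HasDerivAt (deriv f) (deriv (deriv f) z) z :=
      (h1.differentiable (by simp) z).hasDerivAt
    have e3 : HasDerivAt (fun z : ℝ => z ^ (N / 2)) (N / 2 * z ^ (N / 2 - 1)) z :=
      Real.hasDerivAt_rpow_const (Or.inl hzz.1.ne')
    have e := (e3.mul (e1.mul e2)).sub
      ((((e3.mul e2).pow 2).add (e3.mul (e1.pow 2))).div_const 2)
    refine HasDerivAt.congr_deriv (e.congr_of_eventuallyEq (Filter.Eventually.of_forall fun x => ?_)) ?_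
    · simp [hG]
    · simp only [hg, Del, Pi.mul_apply, Pi.pow_apply]
      rw [hz z hzz.1]
      push_cast
      ring
  have hint : ∫ z in (0:ℝ)..1, g z = G 1 - G 0 :=
    intervalIntegral.integral_eq_sub_of_hasDerivAt_of_le zero_le_one cG.continuousOn hd
      (cg.intervalIntegrable _ _)
  have hG0 : G 0 = 0 := by
    simp only [hG]
    rw [Real.zero_rpow (by linarith)]
    ring
  have hG1 : G 1 ≤ 0 := by
    simp only [hG, Real.one_rpow]
    nlinarith [sq_nonneg (f 1 - deriv f 1)]
  have hle : ∫ z in (0:ℝ)..1, ((Ddot f z) ^ 2 * z ^ (N / 2 - 1)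
      - (N / 2 + 3) * ((f z) ^ 2 * z ^ (N / 2 - 1)) - 3 * ((Del N f z) ^ 2 * z ^ (N / 2 - 1)))
      ≤ ∫ z in (0:ℝ)..1, 2 * g z := by
    apply intervalIntegral.integral_mono_on zero_le_one
    · exact Continuous.intervalIntegrable (by fun_prop) _ _
    · exact Continuous.intervalIntegrable (by fun_prop) _ _
    · intro z hzz
      have hw : 0 ≤ z ^ (N / 2 - 1) := Real.rpow_nonneg hzz.1 _
      have hD : (Ddot f z) ^ 2 = z * deriv f z ^ 2 := by
        rw [Ddot, mul_pow, Real.sq_sqrt hzz.1]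
      have p0 : 0 ≤ z ^ (N / 2) := Real.rpow_nonneg hzz.1 _
      have p1 : z ^ (N / 2) ≤ z := by
        rcases hzz.1.eq_or_lt with h | h
        · rw [← h, Real.zero_rpow (by linarith)]
        · calc z ^ (N / 2) ≤ z ^ (1:ℝ) :=
                Real.rpow_le_rpow_of_exponent_ge h hzz.2 (by linarith)
            _ = z := Real.rpow_one z
      have p2 : (z ^ (N / 2)) ^ 2 ≤ z := by nlinarith [hzz.2]
      have p3 : z ^ 2 ≤ z := by nlinarith [hzz.1, hzz.2]
      rw [hD]
      simp only [hg]
      generalize z ^ (N / 2) = p at *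
      generalize z ^ (N / 2 - 1) = w at *
      generalize deriv f z = b at *
      generalize Del N f z = c at *
      generalize f z = a at *
      have q1 := mul_le_mul_of_nonneg_right p2 (sq_nonneg b)
      have q2 := mul_le_mul_of_nonneg_right p3 (sq_nonneg b)
      have : 0 ≤ w * (2 * (z * b ^ 2 + a * c - p * b * c - N / 2 * a ^ 2 / 2 - z * a * b)
          - (z * b ^ 2 - (N / 2 + 3) * a ^ 2 - 3 * c ^ 2)) := by
        apply mul_nonneg hw
        nlinarith [sq_nonneg (a + c), sq_nonneg (p * b / 2 - c), sq_nonneg (z * b / 2 - a)]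
      linarith
  rw [intervalIntegral.integral_const_mul, hint, hG0,
    intervalIntegral.integral_sub (Continuous.intervalIntegrable (by fun_prop) _ _)
      (Continuous.intervalIntegrable (by fun_prop) _ _),
    intervalIntegral.integral_sub (Continuous.intervalIntegrable (by fun_prop) _ _)
      (Continuous.intervalIntegrable (by fun_prop) _ _),
    intervalIntegral.integral_const_mul, intervalIntegral.integral_const_mul] at hle
  linarith

theorem stmt9 (N : ℝ) (hN : 4 ≤ N) (m : ℕ) :
    ∃ C > (0:ℝ), ∀ y : ℝ → ℝ, ContDiff ℝ (⊤ : ℕ∞) y →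
      Xnorm N (Ddot (DelIter N m y))
        ≤ C * (Xnorm N (DelIter N m y) + Xnorm N (DelIter N (m + 1) y)) := by
  refine ⟨N / 2 + 3, by linarith, fun y hy => ?_⟩
  have key := key_ineq N hN _ (delIter_smooth N m y hy)
  change Xnorm N (Ddot (DelIter N m y))
        ≤ (N / 2 + 3) * (Xnorm N (DelIter N m y) + Xnorm N (Del N (DelIter N m y)))
  have hnn : ∀ f : ℝ → ℝ, 0 ≤ ∫ z in (0:ℝ)..1, (f z) ^ 2 * z ^ (N / 2 - 1) := fun f =>
    intervalIntegral.integral_nonneg zero_le_one fun z hz =>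
      mul_nonneg (sq_nonneg _) (Real.rpow_nonneg hz.1 _)
  have hA := Real.sq_sqrt (hnn (DelIter N m y))
  have hB := Real.sq_sqrt (hnn (Del N (DelIter N m y)))
  unfold Xnorm
  have a0 := Real.sqrt_nonneg (∫ z in (0:ℝ)..1, (DelIter N m y z) ^ 2 * z ^ (N / 2 - 1))
  have b0 := Real.sqrt_nonneg (∫ z in (0:ℝ)..1, (Del N (DelIter N m y) z) ^ 2 * z ^ (N / 2 - 1))
  rw [← hA, ← hB] at key
  set A := √(∫ z in (0:ℝ)..1, (DelIter N m y z) ^ 2 * z ^ (N / 2 - 1))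
  set B := √(∫ z in (0:ℝ)..1, (Del N (DelIter N m y) z) ^ 2 * z ^ (N / 2 - 1))
  have hK : (5:ℝ) ≤ N / 2 + 3 := by linarith
  generalize N / 2 + 3 = K at *
  apply Real.sqrt_le_iff.2
  refine ⟨by positivity, key.trans ?_⟩
  have h2 : K ≤ K ^ 2 := by nlinarith
  have h3 : 3 ≤ K ^ 2 := by nlinarith
  have h4 : 0 ≤ K ^ 2 * (A * B) := by positivity
  nlinarith [mul_le_mul_of_nonneg_right h2 (sq_nonneg A), mul_le_mul_of_nonneg_right h3 (sq_nonneg B)]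
end
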